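/- Every connected graph G whose vertex set can be partitioned into three cliques, each of size at least 4, satisfies ps(G) = 3. -/

import Mathlib

open Finset

open scoped Classical in
/-- The product degree of vertex `v`: the product of the labels of the edges incident with `v`. -/
noncomputable def pdeg {V : Type*} [Fintype V] (G : SimpleGraph V) (w : Sym2 V → ℕ) (v : V) : ℕ :=
  ∏ u ∈ Finset.univ.filter (fun u => G.Adj v u), w s(v, u)

/-- A labelling is product-irregular if distinct vertices have distinct product degrees. -/
def ProductIrregular {V : Type*} [Fintype V] (G : SimpleGraph V) (w : Sym2 V → ℕ) : Prop :=
  Function.Injective (pdeg G w)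

/-- The product irregularity strength: the least `s` admitting a product-irregular labelling
with labels in `{1,…,s}`. -/
noncomputable def ps {V : Type*} [Fintype V] (G : SimpleGraph V) : ℕ :=
  sInf {s : ℕ | ∃ w : Sym2 V → ℕ,
    (∀ u v : V, G.Adj u v → w s(u, v) ∈ Finset.Icc 1 s) ∧ ProductIrregular G w}


/-- Full product of labels around a vertex. -/
def PP {V : Type*} [Fintype V] (w : Sym2 V → ℕ) (v : V) : ℕ := ∏ u, w s(v, u)

/-- Labellings of the clique `A` realizing, in presence of outer weights `h`, distinct exponent
pairs lying in `S`. -/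
def Rz {V : Type*} [Fintype V] (p q : ℕ) (A : Finset V) (h : V → ℕ) (S : Set (ℕ × ℕ)) : Prop :=
  ∃ (w : Sym2 V → ℕ) (f : V → ℕ × ℕ), (∀ e, w e ∈ Finset.Icc 1 3) ∧
    (∀ u v, w s(u, v) ≠ 1 → u ∈ A ∧ v ∈ A ∧ u ≠ v) ∧
    (∀ v ∈ A, PP w v * h v = p ^ (f v).1 * q ^ (f v).2) ∧
    Set.InjOn f (A : Set V) ∧ ∀ v ∈ A, f v ∈ S

theorem PP_mul {V : Type*} [Fintype V] (w w' : Sym2 V → ℕ) (v : V) :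
    PP (fun e => w e * w' e) v = PP w v * PP w' v := by
  simp [PP, Finset.prod_mul_distrib]

theorem PP_one {V : Type*} [Fintype V] (w : Sym2 V → ℕ) (v : V) (h : ∀ u, w s(v, u) = 1) :
    PP w v = 1 := by
  simp [PP, h]

theorem Rz.swap {V : Type*} [Fintype V] {p q : ℕ} {A : Finset V} {h : V → ℕ} {S : Set (ℕ × ℕ)}
    (H : Rz p q A h S) : Rz q p A h {x | x.swap ∈ S} := by
  obtain ⟨w, f, h1, h2, h3, h4, h5⟩ := H
  refine ⟨w, fun v => (f v).swap, h1, h2, ?_, ?_, ?_⟩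
  · intro v hv
    rw [h3 v hv]; simp [mul_comm]
  · intro x hx y hy hxy
    exact h4 hx hy (Prod.swap_injective hxy)
  · intro v hv
    simpa using h5 v hv

theorem enc_inj (a b : ℕ × ℕ) (h : 2 ^ a.1 * 3 ^ a.2 = 2 ^ b.1 * 3 ^ b.2) : a = b := by
  have h2 := congrArg (fun n => n.factorization 2) h
  have h3 := congrArg (fun n => n.factorization 3) h
  beta_reduce at h2 h3
  rw [Nat.factorization_mul (by positivity) (by positivity),
    Nat.factorization_mul (by positivity) (by positivity)] at h2 h3
  have e1 : Nat.factorization 3 2 = 0 := Nat.factorization_eq_zero_of_not_dvd (by norm_num)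
  have e2 : Nat.factorization 2 3 = 0 := Nat.factorization_eq_zero_of_not_dvd (by norm_num)
  have e3 : Nat.factorization 2 2 = 1 := Nat.Prime.factorization_self (by norm_num)
  have e4 : Nat.factorization 3 3 = 1 := Nat.Prime.factorization_self (by norm_num)
  simp [Nat.factorization_pow, e1, e2, e3, e4] at h2 h3
  exact Prod.ext h2 h3

theorem Rz.congr {V : Type*} [Fintype V] {p q : ℕ} {A : Finset V} {h h' : V → ℕ}
    {S S' : Set (ℕ × ℕ)} (H : Rz p q A h S) (hh : ∀ v ∈ A, h' v = h v) (hS : ∀ x ∈ S, x ∈ S') :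
    Rz p q A h' S' := by
  obtain ⟨w, f, h1, h2, h3, h4, h5⟩ := H
  refine ⟨w, f, h1, h2, ?_, h4, fun v hv => hS _ (h5 v hv)⟩
  intro v hv
  rw [hh v hv, h3 v hv]

theorem Rz.iso {V : Type*} [Fintype V] [DecidableEq V] {p q : ℕ} {A : Finset V} {h : V → ℕ}
    {S S' : Set (ℕ × ℕ)} {x : V} (H : Rz p q A h S) (hx : x ∉ A) (hhx : h x = 1)
    (hS : ∀ s ∈ S, s ∈ S' ∧ s ≠ (0, 0)) (h0 : (0, 0) ∈ S') :
    Rz p q (insert x A) h S' := by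
  obtain ⟨w, f, h1, h2, h3, h4, h5⟩ := H
  have hne : ∀ v ∈ A, v ≠ x := fun v hv e => hx (e ▸ hv)
  refine ⟨w, fun v => if v = x then (0, 0) else f v, h1, ?_, ?_, ?_, ?_⟩
  · intro u v huv
    have := h2 u v huv
    simp [this]
  · intro v hv
    rcases Finset.mem_insert.1 hv with rfl | hv
    · rw [PP_one]
      · simp [hhx]
      · intro u; by_contra hc; exact hx (h2 _ _ hc).1
    · simp [hne v hv, h3 v hv]
  · intro u hu v hv huv
    simp only [Finset.coe_insert, Set.mem_insert_iff, Finset.mem_coe] at hu hv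
    rcases hu with rfl | hu <;> rcases hv with rfl | hv
    · rfl
    · simp [hne v hv] at huv
      exact absurd huv.symm (hS _ (h5 v hv)).2
    · simp [hne u hu] at huv
      exact absurd huv (hS _ (h5 u hu)).2
    · simp [hne u hu, hne v hv] at huv
      exact h4 hu hv huv
  · intro v hv
    rcases Finset.mem_insert.1 hv with rfl | hv
    · simp [h0]
    · simpa [hne v hv] using (hS _ (h5 v hv)).1

theorem Rz.red {V : Type*} [Fintype V] [DecidableEq V] {p q j : ℕ} (hp : p ∈ Finset.Icc 1 3)
    {A : Finset V} {h : V → ℕ}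
    {S S' : Set (ℕ × ℕ)} {x : V} (H : Rz p q A h S) (hx : x ∉ A) (hhx : h x = p ^ j)
    (hS : ∀ s ∈ S, (s.1 + 1, s.2) ∈ S' ∧ (s.1 + 1, s.2) ≠ (A.card + j, 0))
    (h0 : (A.card + j, 0) ∈ S') :
    Rz p q (insert x A) h S' := by
  obtain ⟨w, f, h1, h2, h3, h4, h5⟩ := H
  have hne : ∀ v ∈ A, v ≠ x := fun v hv e => hx (e ▸ hv)
  have hw1 : ∀ u, w s(x, u) = 1 := by
    intro u; by_contra hc; exact hx (h2 _ _ hc).1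
  set c : Sym2 V → ℕ := fun e => if ∃ u ∈ A, e = s(x, u) then p else 1 with hc
  have c1 : ∀ v, c s(x, v) = if v ∈ A then p else 1 := by
    intro v
    simp only [hc]
    congr 1
    simp only [Sym2.eq_iff, eq_iff_iff]
    constructor
    · rintro ⟨u, hu, (⟨_, rfl⟩ | ⟨rfl, rfl⟩)⟩ <;> exact hu
    · intro hv; exact ⟨v, hv, by simp⟩
  have c2 : ∀ v ∈ A, ∀ u, c s(v, u) = if u = x then p else 1 := by
    intro v hv u
    simp only [hc]
    congr 1
    simp only [Sym2.eq_iff, eq_iff_iff]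
    constructor
    · rintro ⟨u', hu, (⟨rfl, rfl⟩ | ⟨rfl, rfl⟩)⟩
      · exact absurd rfl (hne _ hv)
      · rfl
    · rintro rfl; exact ⟨v, hv, Or.inr ⟨rfl, rfl⟩⟩
  refine ⟨fun e => w e * c e, fun v => if v = x then (A.card + j, 0) else ((f v).1 + 1, (f v).2),
    ?_, ?_, ?_, ?_, ?_⟩
  · intro e
    beta_reduce
    by_cases hce : ∃ u ∈ A, e = s(x, u)
    · obtain ⟨u, hu, rfl⟩ := hce
      rw [hw1, c1, if_pos hu, one_mul]; exact hp
    · have : c e = 1 := by simp only [hc]; rw [if_neg hce]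
      rw [this, mul_one]; exact h1 e
  · intro u v huv
    beta_reduce at huv
    by_cases hw : w s(u, v) = 1
    · rw [hw, one_mul] at huv
      have : ∃ y ∈ A, s(u, v) = s(x, y) := by
        by_contra hcon
        apply huv
        simp only [hc]; rw [if_neg hcon]
      obtain ⟨y, hy, he⟩ := this
      rw [Sym2.eq_iff] at he
      rcases he with ⟨rfl, rfl⟩ | ⟨rfl, rfl⟩
      · exact ⟨by simp, by simp [hy], (hne _ hy).symm⟩
      · exact ⟨by simp [hy], by simp, hne _ hy⟩
    · have := h2 u v hw
      simp [this]
  · intro v hv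
    rw [PP_mul]
    rcases Finset.mem_insert.1 hv with rfl | hv
    · rw [PP_one w v hw1]
      simp only [PP, c1, hhx]
      rw [Finset.prod_ite]
      simp [pow_add]
    · have : PP c v = p := by
        simp only [PP, c2 v hv]
        simp
      rw [this]
      simp only [hne v hv, if_false]
      calc PP w v * p * h v = (PP w v * h v) * p := by ring
        _ = _ := by rw [h3 v hv]; ring
  · intro u hu v hv huv
    simp only [Finset.coe_insert, Set.mem_insert_iff, Finset.mem_coe] at hu hv
    rcases hu with rfl | hu <;> rcases hv with rfl | hv
    · rfl
    · simp only [hne v hv, if_true, if_false] at huv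
      exact absurd huv.symm (hS _ (h5 v hv)).2
    · simp only [hne u hu, if_true, if_false] at huv
      exact absurd huv (hS _ (h5 u hu)).2
    · simp only [hne u hu, hne v hv, if_false, Prod.mk.injEq, Nat.add_right_cancel_iff] at huv
      exact h4 hu hv (Prod.ext huv.1 huv.2)
  · intro v hv
    rcases Finset.mem_insert.1 hv with rfl | hv
    · simp [h0]
    · simpa [hne v hv] using (hS _ (h5 v hv)).1

/-- Explicit small gadgets. -/
theorem Rz.table {V : Type*} [Fintype V] [DecidableEq V] {p q n : ℕ} {A : Finset V} {h : V → ℕ}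
    (e : Fin n → V) (he : Function.Injective e) (heA : Finset.univ.image e = A)
    (t : Fin n → Fin n → ℕ) (hh : Fin n → ℕ) (g : Fin n → ℕ × ℕ)
    (hhe : ∀ i, h (e i) = hh i)
    (ht : ∀ i j, t i j = t j i ∧ t i j ∈ Finset.Icc 1 3 ∧ t i i = 1)
    (hg : ∀ i, (∏ j, t i j) * hh i = p ^ (g i).1 * q ^ (g i).2)
    (hgi : Function.Injective g) : Rz p q A h (Set.range g) := by
  classical
  by_cases hn : n = 0
  · subst hn
    have : A = ∅ := by rw [← heA]; simp
    subst this
    exact ⟨fun _ => 1, fun _ => (0, 0), by simp, by simp, by simp, by simp, by simp⟩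
  have : NeZero n := ⟨hn⟩
  have : Nonempty (Fin n) := ⟨0⟩
  set r := Function.invFun e with hr
  have hre : ∀ i, r (e i) = i := Function.leftInverse_invFun he
  have hA : ∀ v ∈ A, ∃ i, e i = v := by
    intro v hv; rw [← heA] at hv; simpa using hv
  have hA' : ∀ i, e i ∈ A := by
    intro i; rw [← heA]; simp
  refine ⟨Sym2.lift ⟨fun u v => if u ∈ A ∧ v ∈ A then t (r u) (r v) else 1, ?_⟩, fun v => g (r v),
    ?_, ?_, ?_, ?_, ?_⟩
  · intro u v
    simp only [and_comm, (ht (r u) (r v)).1]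
  · intro z
    induction z using Sym2.ind with
    | _ u v =>
      simp only [Sym2.lift_mk]
      split_ifs
      · exact (ht _ _).2.1
      · simp
  · intro u v huv
    simp only [Sym2.lift_mk] at huv
    split_ifs at huv with hc
    · refine ⟨hc.1, hc.2, ?_⟩
      rintro rfl
      exact huv (ht _ (r u)).2.2
    · simp at huv
  · intro v hv
    obtain ⟨i, rfl⟩ := hA v hv
    beta_reduce
    rw [hre, ← hg, hhe]
    congr 1
    simp only [PP, Sym2.lift_mk, hA', true_and, hre]
    rw [← Finset.prod_filter]
    have : Finset.univ.filter (· ∈ A) = Finset.univ.image e := by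
      rw [heA]; ext; simp
    rw [this, Finset.prod_image (fun _ _ _ _ h => he h)]
    simp [hre]
  · intro u hu v hv huv
    obtain ⟨i, rfl⟩ := hA u hu
    obtain ⟨j, rfl⟩ := hA v hv
    simp only [hre] at huv
    rw [hgi huv]
  · intro v hv
    simp

theorem enum2 {V : Type*} [DecidableEq V] {n : ℕ} (A : Finset V) (hn : A.card = n + 2)
    {a b : V} (ha : a ∈ A) (hb : b ∈ A) (hab : a ≠ b) :
    ∃ e : Fin (n + 2) → V, Function.Injective e ∧ Finset.univ.image e = A ∧ e 0 = a ∧ e 1 = b := by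
  let e0 : Fin (n + 2) ≃ A := (A.equivFinOfCardEq hn).symm
  let e1 : Fin (n + 2) ≃ A := (Equiv.swap 0 (e0.symm ⟨a, ha⟩)).trans e0
  have h1 : e1 0 = ⟨a, ha⟩ := by simp [e1]
  let e2 : Fin (n + 2) ≃ A := (Equiv.swap 1 (e1.symm ⟨b, hb⟩)).trans e1
  have h2 : e2 1 = ⟨b, hb⟩ := by simp [e2]
  have h3 : e2 0 = ⟨a, ha⟩ := by
    have : (0 : Fin (n + 2)) ≠ e1.symm ⟨b, hb⟩ := by
      intro h
      rw [Equiv.eq_symm_apply, h1] at h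
      exact hab (congrArg Subtype.val h)
    simp only [e2, Equiv.trans_apply]
    rw [Equiv.swap_apply_of_ne_of_ne (by simp) this, h1]
  refine ⟨fun i => (e2 i : V), ?_, ?_, by simp [h3], by simp [h2]⟩
  · intro i j hij
    exact e2.injective (Subtype.ext hij)
  · ext v
    simp only [Finset.mem_image, Finset.mem_univ, true_and]
    constructor
    · rintro ⟨i, rfl⟩; exact (e2 i).2
    · intro hv
      exact ⟨e2.symm ⟨v, hv⟩, by simp⟩

theorem enum1 {V : Type*} [DecidableEq V] {n : ℕ} (A : Finset V) (hn : A.card = n + 2)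
    {a : V} (ha : a ∈ A) :
    ∃ e : Fin (n + 2) → V, Function.Injective e ∧ Finset.univ.image e = A ∧ e 0 = a := by
  obtain ⟨b, hb, hab⟩ := Finset.exists_mem_ne (by omega : 1 < A.card) a
  obtain ⟨e, h1, h2, h3, _⟩ := enum2 A hn ha hb hab.symm
  exact ⟨e, h1, h2, h3⟩

theorem enum0 {V : Type*} [DecidableEq V] {n : ℕ} (A : Finset V) (hn : A.card = n + 2) :
    ∃ e : Fin (n + 2) → V, Function.Injective e ∧ Finset.univ.image e = A := by
  obtain ⟨a, ha⟩ := Finset.card_pos.1 (by omega : 0 < A.card)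
  obtain ⟨e, h1, h2, _⟩ := enum1 A hn ha
  exact ⟨e, h1, h2⟩

/-- Upper bound predicate. -/
def Up {V : Type*} [Fintype V] (G : SimpleGraph V) : Prop :=
  ∃ w : Sym2 V → ℕ, (∀ u v : V, G.Adj u v → w s(u, v) ∈ Finset.Icc 1 3) ∧ ProductIrregular G w

theorem union_up {V : Type*} [Fintype V] [DecidableEq V] (G : SimpleGraph V) {A B C : Finset V}
    (hU : A ∪ B ∪ C = Finset.univ)
    (hAB : Disjoint A B) (hAC : Disjoint A C) (hBC : Disjoint B C)
    (cA : G.IsClique (A : Set V)) (cB : G.IsClique (B : Set V)) (cC : G.IsClique (C : Set V))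
    (wX : Sym2 V → ℕ) (hX1 : ∀ e, wX e ∈ Finset.Icc 1 3)
    (hX2 : ∀ u v, wX s(u, v) ≠ 1 → G.Adj u v ∧ ¬ (u ∈ A ∧ v ∈ A) ∧ ¬ (u ∈ B ∧ v ∈ B)
      ∧ ¬ (u ∈ C ∧ v ∈ C))
    {SA SB SC : Set (ℕ × ℕ)}
    (RA : Rz 2 3 A (PP wX) SA) (RB : Rz 2 3 B (PP wX) SB) (RC : Rz 2 3 C (PP wX) SC)
    (dAB : ∀ x ∈ SA, x ∉ SB) (dAC : ∀ x ∈ SA, x ∉ SC) (dBC : ∀ x ∈ SB, x ∉ SC) : Up G := by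
  obtain ⟨w1, f1, a1, a2, a3, a4, a5⟩ := RA
  obtain ⟨w2, f2, b1, b2, b3, b4, b5⟩ := RB
  obtain ⟨w3, f3, c1, c2, c3, c4, c5⟩ := RC
  rw [Finset.disjoint_left] at hAB hAC hBC
  have hcov : ∀ v, v ∈ A ∨ v ∈ B ∨ v ∈ C := by
    intro v
    have : v ∈ A ∪ B ∪ C := by rw [hU]; simp
    simpa [or_assoc] using this
  have o1 : ∀ v, v ∉ A → PP w1 v = 1 := fun v hv =>
    PP_one _ _ (fun u => by by_contra hc; exact hv (a2 _ _ hc).1)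
  have o2 : ∀ v, v ∉ B → PP w2 v = 1 := fun v hv =>
    PP_one _ _ (fun u => by by_contra hc; exact hv (b2 _ _ hc).1)
  have o3 : ∀ v, v ∉ C → PP w3 v = 1 := fun v hv =>
    PP_one _ _ (fun u => by by_contra hc; exact hv (c2 _ _ hc).1)
  set w : Sym2 V → ℕ := fun e => ((w1 e * w2 e) * w3 e) * wX e with hw
  have hPP : ∀ v, pdeg G w v = PP w1 v * PP w2 v * PP w3 v * PP wX v := by
    intro v
    rw [← PP_mul, ← PP_mul, ← PP_mul]
    simp only [pdeg, PP]
    rw [Finset.prod_filter]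
    refine Finset.prod_congr rfl fun u _ => ?_
    split_ifs with h
    · rfl
    · by_contra hc
      apply h
      by_cases k1 : w1 s(v, u) = 1
      · by_cases k2 : w2 s(v, u) = 1
        · by_cases k3 : w3 s(v, u) = 1
          · by_cases k4 : wX s(v, u) = 1
            · simp [k1, k2, k3, k4] at hc
            · exact (hX2 _ _ k4).1
          · have := c2 _ _ k3
            exact cC this.1 this.2.1 this.2.2
        · have := b2 _ _ k2
          exact cB this.1 this.2.1 this.2.2
      · have := a2 _ _ k1
        exact cA this.1 this.2.1 this.2.2
  have eA : ∀ v ∈ A, pdeg G w v = 2 ^ (f1 v).1 * 3 ^ (f1 v).2 := by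
    intro v hv
    rw [hPP, o2 v (hAB hv), o3 v (hAC hv), mul_one, mul_one, a3 v hv]
  have eB : ∀ v ∈ B, pdeg G w v = 2 ^ (f2 v).1 * 3 ^ (f2 v).2 := by
    intro v hv
    rw [hPP, o1 v (fun h => hAB h hv), o3 v (hBC hv), mul_one, one_mul, b3 v hv]
  have eC : ∀ v ∈ C, pdeg G w v = 2 ^ (f3 v).1 * 3 ^ (f3 v).2 := by
    intro v hv
    rw [hPP, o1 v (fun h => hAC h hv), o2 v (fun h => hBC h hv), mul_one, one_mul, c3 v hv]
  refine ⟨w, ?_, ?_⟩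
  · intro u v _
    simp only [hw]
    have q1 := a2 u v
    have q2 := b2 u v
    have q3 := c2 u v
    have q4 := hX2 u v
    by_cases k1 : w1 s(u, v) = 1
    · by_cases k2 : w2 s(u, v) = 1
      · by_cases k3 : w3 s(u, v) = 1
        · simpa [k1, k2, k3] using hX1 s(u, v)
        · have k4 : wX s(u, v) = 1 := by
            by_contra k; exact (q4 k).2.2.2 ⟨(q3 k3).1, (q3 k3).2.1⟩
          simpa [k1, k2, k4] using c1 s(u, v)
      · have k3 : w3 s(u, v) = 1 := by
          by_contra k; exact hBC (q2 k2).1 (q3 k).1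
        have k4 : wX s(u, v) = 1 := by
          by_contra k; exact (q4 k).2.2.1 ⟨(q2 k2).1, (q2 k2).2.1⟩
        simpa [k1, k3, k4] using b1 s(u, v)
    · have k2 : w2 s(u, v) = 1 := by
        by_contra k; exact hAB (q1 k1).1 (q2 k).1
      have k3 : w3 s(u, v) = 1 := by
        by_contra k; exact hAC (q1 k1).1 (q3 k).1
      have k4 : wX s(u, v) = 1 := by
        by_contra k; exact (q4 k).2.1 ⟨(q1 k1).1, (q1 k1).2.1⟩
      simpa [k2, k3, k4] using a1 s(u, v)
  · intro u v huv
    rcases hcov u with hu | hu | hu <;> rcases hcov v with hv | hv | hv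
    · rw [eA u hu, eA v hv] at huv; exact a4 hu hv (enc_inj _ _ huv)
    · rw [eA u hu, eB v hv] at huv
      exact absurd (enc_inj _ _ huv ▸ b5 v hv) (dAB _ (a5 u hu))
    · rw [eA u hu, eC v hv] at huv
      exact absurd (enc_inj _ _ huv ▸ c5 v hv) (dAC _ (a5 u hu))
    · rw [eB u hu, eA v hv] at huv
      exact absurd (enc_inj _ _ huv ▸ b5 u hu) (dAB _ (a5 v hv))
    · rw [eB u hu, eB v hv] at huv; exact b4 hu hv (enc_inj _ _ huv)
    · rw [eB u hu, eC v hv] at huv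
      exact absurd (enc_inj _ _ huv ▸ c5 v hv) (dBC _ (b5 u hu))
    · rw [eC u hu, eA v hv] at huv
      exact absurd (enc_inj _ _ huv ▸ c5 u hu) (dAC _ (a5 v hv))
    · rw [eC u hu, eB v hv] at huv
      exact absurd (enc_inj _ _ huv ▸ c5 u hu) (dBC _ (b5 v hv))
    · rw [eC u hu, eC v hv] at huv; exact c4 hu hv (enc_inj _ _ huv)

theorem out_edge {V : Type*} (G : SimpleGraph V) (hconn : G.Connected) (A : Finset V)
    {a b : V} (ha : a ∈ A) (hb : b ∉ A) : ∃ u ∈ A, ∃ v, v ∉ A ∧ G.Adj u v := by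
  obtain ⟨p⟩ := hconn.preconnected a b
  obtain ⟨d, _, h1, h2⟩ := p.exists_boundary_dart (A : Set V) ha hb
  exact ⟨d.fst, h1, d.snd, h2, d.adj⟩

theorem lower {V : Type*} [Fintype V] (G : SimpleGraph V) (hV : 2 ≤ Fintype.card V)
    (s : ℕ) (w : Sym2 V → ℕ) (hw : ∀ u v : V, G.Adj u v → w s(u, v) ∈ Finset.Icc 1 s)
    (hi : ProductIrregular G w) : 3 ≤ s := by
  classical
  by_contra hs
  let H : SimpleGraph V :=
    { Adj := fun u v => G.Adj u v ∧ w s(u, v) = 2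
      symm := ⟨fun u v h => ⟨h.1.symm, by rw [Sym2.eq_swap]; exact h.2⟩⟩
      loopless := ⟨fun u h => G.loopless.irrefl u h.1⟩ }
  have hd : ∀ v, pdeg G w v = 2 ^ H.degree v := by
    intro v
    have : H.degree v = ((Finset.univ.filter (fun u => G.Adj v u)).filter
        (fun u => w s(v, u) = 2)).card := by
      rw [← SimpleGraph.card_neighborFinset_eq_degree]
      congr 1
      ext u
      simp [H]
    rw [this, ← Finset.prod_const, Finset.prod_filter, pdeg]
    refine Finset.prod_congr (by ext; simp) fun u hu => ?_
    have := hw v u (by simpa using hu)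
    rw [Finset.mem_Icc] at this
    split_ifs <;> omega
  have hinj : Function.Injective (fun v => (⟨H.degree v, H.degree_lt_card_verts v⟩ :
      Fin (Fintype.card V))) := by
    intro u v huv
    apply hi
    rw [hd, hd]
    simp only [Fin.mk.injEq] at huv
    rw [huv]
  have hsurj := ((Fintype.bijective_iff_injective_and_card _).2 ⟨hinj, by simp⟩).2
  obtain ⟨x, hx⟩ := hsurj ⟨0, by omega⟩
  obtain ⟨y, hy⟩ := hsurj ⟨Fintype.card V - 1, by omega⟩
  simp only [Fin.mk.injEq] at hx hy
  have hxy : x ≠ y := by rintro rfl; omega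
  have h1 : H.neighborFinset y = Finset.univ.erase y := by
    apply Finset.eq_of_subset_of_card_le
    · intro z hz
      simp only [SimpleGraph.mem_neighborFinset] at hz
      simp [hz.ne']
    · rw [SimpleGraph.card_neighborFinset_eq_degree, hy]; simp
  have h2 : x ∈ H.neighborFinset y := by rw [h1]; simp [hxy]
  rw [SimpleGraph.mem_neighborFinset] at h2
  have := (H.degree_pos_iff_exists_adj x).2 ⟨y, h2.symm⟩
  omega
set_option linter.unusedSimpArgs false

theorem base3 {V : Type*} [Fintype V] [DecidableEq V] {p q : ℕ} (hp : p ∈ Finset.Icc 1 3)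
    (hq : q ∈ Finset.Icc 1 3) (A : Finset V) (h : V → ℕ) (hA : A.card = 3)
    (hh : ∀ v ∈ A, h v = 1) :
    Rz p q A h {x | x = (1, 0) ∨ x = (0, 1) ∨ x = (1, 1)} := by
  obtain ⟨e, he1, he2⟩ := enum0 (n := 1) A hA
  have := Rz.table (p := p) (q := q) (h := h) e he1 he2 ![![1, 1, p], ![1, 1, q], ![p, q, 1]]
    (fun _ => 1) ![(1, 0), (0, 1), (1, 1)] (fun i => hh _ (by rw [← he2]; simp))
    (by
      rw [Finset.mem_Icc] at hp hq
      intro i j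
      fin_cases i <;> fin_cases j <;> simp [hp, hq])
    (by
      intro i
      fin_cases i <;> simp [Fin.prod_univ_three])
    (by decide)
  refine this.congr (fun _ _ => rfl) ?_
  rintro x ⟨i, rfl⟩
  fin_cases i <;> simp

/-- Line type, last vertex isolated. -/
def Siso (m : ℕ) : Set (ℕ × ℕ) :=
  {x | (x.2 = 0 ∧ x.1 ≤ m + 1) ∨ (x.2 = 1 ∧ (x.1 = m / 2 ∨ x.1 = m / 2 + 1))}

/-- Line type, last vertex dominating. -/
def Sred (m : ℕ) : Set (ℕ × ℕ) :=
  {x | (x.2 = 0 ∧ 1 ≤ x.1 ∧ x.1 ≤ m + 2) ∨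
    (x.2 = 1 ∧ (x.1 = (m + 1) / 2 ∨ x.1 = (m + 1) / 2 + 1))}

/-- Diagonal type. -/
def Sdia (m : ℕ) : Set (ℕ × ℕ) :=
  {x | (x.1 + x.2 = m + 2 ∧ 1 ≤ x.1) ∨ (x.1 = (m + 1) / 2 + 1 ∧ x.2 = m / 2) ∨
    (x.1 = (m + 1) / 2 ∧ x.2 = m / 2 + 1)}

/-- Diagonal type, with an outer edge. -/
def Sdia' (m : ℕ) : Set (ℕ × ℕ) :=
  {x | (x.1 + x.2 = m + 2 ∧ 1 ≤ x.1 ∧ 1 ≤ x.2) ∨ (x.1 = m + 3 ∧ x.2 = 0) ∨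
    (x.1 = (m + 1) / 2 + 1 ∧ x.2 = m / 2) ∨ (x.1 = (m + 1) / 2 ∧ x.2 = m / 2 + 1)}

theorem mem_Siso (m a b : ℕ) : (a, b) ∈ Siso m ↔
    ((b = 0 ∧ a ≤ m + 1) ∨ (b = 1 ∧ (a = m / 2 ∨ a = m / 2 + 1))) := Iff.rfl

theorem mem_Sred (m a b : ℕ) : (a, b) ∈ Sred m ↔ ((b = 0 ∧ 1 ≤ a ∧ a ≤ m + 2) ∨
    (b = 1 ∧ (a = (m + 1) / 2 ∨ a = (m + 1) / 2 + 1))) := Iff.rfl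

theorem mem_Sdia (m a b : ℕ) : (a, b) ∈ Sdia m ↔
    ((a + b = m + 2 ∧ 1 ≤ a) ∨ (a = (m + 1) / 2 + 1 ∧ b = m / 2) ∨
    (a = (m + 1) / 2 ∧ b = m / 2 + 1)) := Iff.rfl

theorem mem_Sdia' (m a b : ℕ) : (a, b) ∈ Sdia' m ↔
    ((a + b = m + 2 ∧ 1 ≤ a ∧ 1 ≤ b) ∨ (a = m + 3 ∧ b = 0) ∨
    (a = (m + 1) / 2 + 1 ∧ b = m / 2) ∨ (a = (m + 1) / 2 ∧ b = m / 2 + 1)) := Iff.rfl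

theorem mem_swap (S : Set (ℕ × ℕ)) (a b : ℕ) : (a, b) ∈ {x : ℕ × ℕ | x.swap ∈ S} ↔ (b, a) ∈ S :=
  Iff.rfl

theorem red_of_iso {V : Type*} [Fintype V] [DecidableEq V] {p q : ℕ} (hp : p ∈ Finset.Icc 1 3)
    (h : V → ℕ) (m : ℕ)
    (H : ∀ A : Finset V, A.card = m + 3 → (∀ v ∈ A, h v = 1) → Rz p q A h (Siso m))
    (A : Finset V) (hA : A.card = m + 4) (hh : ∀ v ∈ A, h v = 1) :
    Rz p q A h (Sred (m + 1)) := by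
  obtain ⟨x, hx⟩ := Finset.card_pos.1 (by omega : 0 < A.card)
  have hc : (A.erase x).card = m + 3 := by rw [Finset.card_erase_of_mem hx]; omega
  have := H (A.erase x) hc (fun v hv => hh v (Finset.mem_of_mem_erase hv))
  rw [← Finset.insert_erase hx]
  refine this.red (j := 0) hp (by simp) (by simp [hh x hx]) ?_ ?_
  · rintro ⟨a, b⟩ hs
    rw [hc]
    simp only [mem_swap, mem_Siso, mem_Sred, mem_Sdia, mem_Sdia', ne_eq, Prod.mk.injEq] at hs ⊢
    omega
  · rw [hc]
    rw [mem_Sred]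
    omega

theorem rz_iso {V : Type*} [Fintype V] [DecidableEq V] {p q : ℕ} (hp : p ∈ Finset.Icc 1 3)
    (hq : q ∈ Finset.Icc 1 3) (h : V → ℕ) (m : ℕ) :
    ∀ A : Finset V, A.card = m + 3 → (∀ v ∈ A, h v = 1) → Rz p q A h (Siso m) := by
  induction m using Nat.strong_induction_on with
  | _ m ih =>
    intro A hA hh
    rcases m with _ | m
    · refine (base3 hp hq A h hA hh).congr (fun _ _ => rfl) ?_
      rintro x (rfl | rfl | rfl) <;> simp [Siso]
    obtain ⟨x, hx⟩ := Finset.card_pos.1 (by omega : 0 < A.card)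
    have hc : (A.erase x).card = m + 3 := by rw [Finset.card_erase_of_mem hx]; omega
    have hh' : ∀ v ∈ A.erase x, h v = 1 := fun v hv => hh v (Finset.mem_of_mem_erase hv)
    rw [← Finset.insert_erase hx]
    rcases m with _ | m
    · have := base3 hp hq (A.erase x) h hc hh'
      refine this.iso (by simp) (hh x hx) ?_ (by simp [Siso])
      rintro x (rfl | rfl | rfl) <;> simp [Siso]
    · have := red_of_iso hp h m (ih m (by omega)) (A.erase x) (by omega) hh'
      refine this.iso (by simp) (hh x hx) ?_ (by simp [Siso])
      rintro ⟨a, b⟩ hs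
      simp only [mem_swap, mem_Siso, mem_Sred, mem_Sdia, mem_Sdia', ne_eq, Prod.mk.injEq] at hs ⊢
      omega

theorem rz_red {V : Type*} [Fintype V] [DecidableEq V] {p q : ℕ} (hp : p ∈ Finset.Icc 1 3)
    (hq : q ∈ Finset.Icc 1 3) (h : V → ℕ) (m : ℕ) (A : Finset V) (hA : A.card = m + 4)
    (hh : ∀ v ∈ A, h v = 1) : Rz p q A h (Sred (m + 1)) :=
  red_of_iso hp h m (rz_iso hp hq h m) A hA hh

theorem rz_dia {V : Type*} [Fintype V] [DecidableEq V] (h : V → ℕ) (m : ℕ) :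
    ∀ p q : ℕ, p ∈ Finset.Icc 1 3 → q ∈ Finset.Icc 1 3 →
    ∀ A : Finset V, A.card = m + 3 → (∀ v ∈ A, h v = 1) → Rz p q A h (Sdia m) := by
  induction m with
  | zero =>
    intro p q hp hq A hA hh
    refine (base3 hp hq A h hA hh).congr (fun _ _ => rfl) ?_
    rintro x (rfl | rfl | rfl) <;> simp [Sdia]
  | succ m ih =>
    intro p q hp hq A hA hh
    obtain ⟨x, hx⟩ := Finset.card_pos.1 (by omega : 0 < A.card)
    have hc : (A.erase x).card = m + 3 := by rw [Finset.card_erase_of_mem hx]; omega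
    have hh' : ∀ v ∈ A.erase x, h v = 1 := fun v hv => hh v (Finset.mem_of_mem_erase hv)
    rw [← Finset.insert_erase hx]
    have := (ih q p hq hp (A.erase x) hc hh').swap
    refine this.red (j := 0) hp (by simp) (by simp [hh x hx]) ?_ ?_
    · rintro ⟨a, b⟩ hs
      rw [hc]
      simp only [mem_swap, mem_Siso, mem_Sred, mem_Sdia, mem_Sdia', ne_eq, Prod.mk.injEq] at hs ⊢
      omega
    · rw [hc]
      rw [mem_Sdia]
      omega

theorem rz_dia' {V : Type*} [Fintype V] [DecidableEq V] (h : V → ℕ) (m : ℕ)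
    (p q : ℕ) (hp : p ∈ Finset.Icc 1 3) (hq : q ∈ Finset.Icc 1 3)
    (A : Finset V) (hA : A.card = m + 4) (x : V) (hx : x ∈ A) (hhx : h x = p)
    (hh : ∀ v ∈ A, v ≠ x → h v = 1) : Rz p q A h (Sdia' (m + 1)) := by
  have hc : (A.erase x).card = m + 3 := by rw [Finset.card_erase_of_mem hx]; omega
  have hh' : ∀ v ∈ A.erase x, h v = 1 := fun v hv =>
    hh v (Finset.mem_of_mem_erase hv) (Finset.ne_of_mem_erase hv)
  rw [← Finset.insert_erase hx]
  have := (rz_dia h m q p hq hp (A.erase x) hc hh').swap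
  refine this.red (j := 1) hp (by simp) (by simp [hhx]) ?_ ?_
  · rintro ⟨a, b⟩ hs
    rw [hc]
    simp only [mem_swap, mem_Siso, mem_Sred, mem_Sdia, mem_Sdia', ne_eq, Prod.mk.injEq] at hs ⊢
    omega
  · rw [hc]
    rw [mem_Sdia']
    omega

/-- Partition into three cliques. -/
def TriPart {V : Type*} [Fintype V] [DecidableEq V] (G : SimpleGraph V) (A B C : Finset V) : Prop :=
  A ∪ B ∪ C = Finset.univ ∧ Disjoint A B ∧ Disjoint A C ∧ Disjoint B C ∧
    G.IsClique (A : Set V) ∧ G.IsClique (B : Set V) ∧ G.IsClique (C : Set V)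

/-- Label `2` on a single edge. -/
def wE {V : Type*} [DecidableEq V] (a b : V) (e : Sym2 V) : ℕ := if e = s(a, b) then 2 else 1

theorem wE_mem {V : Type*} [DecidableEq V] (a b : V) (e : Sym2 V) :
    wE a b e ∈ Finset.Icc 1 3 := by
  unfold wE; split_ifs <;> simp

theorem wE_ne {V : Type*} [DecidableEq V] {a b u v : V} (h : wE a b s(u, v) ≠ 1) :
    (u = a ∧ v = b) ∨ (u = b ∧ v = a) := by
  unfold wE at h
  split_ifs at h with h1
  · simpa [Sym2.eq_iff] using h1
  · simp at h

theorem PP_wE {V : Type*} [Fintype V] [DecidableEq V] {a b : V} (hab : a ≠ b) (v : V) :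
    PP (wE a b) v = if v = a ∨ v = b then 2 else 1 := by
  unfold PP wE
  by_cases h1 : v = a
  · subst h1
    have : ∀ u, (s(v, u) = s(v, b)) ↔ u = b := by intro u; rw [Sym2.eq_iff]; tauto
    simp [this]
  · by_cases h2 : v = b
    · subst h2
      have : ∀ u, (s(v, u) = s(a, v)) ↔ u = a := by
        intro u; rw [Sym2.eq_iff]; tauto
      simp [this]
    · have : ∀ u, ¬ (s(v, u) = s(a, b)) := by
        intro u; rw [Sym2.eq_iff]; tauto
      simp [this, h1, h2]

theorem cross {V : Type*} {A B C : Finset V} (hAB : ∀ ⦃a : V⦄, a ∈ A → a ∉ B)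
    (hAC : ∀ ⦃a : V⦄, a ∈ A → a ∉ C) (hBC : ∀ ⦃a : V⦄, a ∈ B → a ∉ C) {u v : V}
    (h : (u ∈ A ∧ v ∈ B) ∨ (u ∈ A ∧ v ∈ C) ∨ (u ∈ B ∧ v ∈ C)) :
    ¬ (u ∈ A ∧ v ∈ A) ∧ ¬ (u ∈ B ∧ v ∈ B) ∧ ¬ (u ∈ C ∧ v ∈ C) := by
  rcases h with ⟨h1, h2⟩ | ⟨h1, h2⟩ | ⟨h1, h2⟩
  · exact ⟨fun h => hAB h.2 h2, fun h => hAB h1 h.1, fun h => hAC h1 h.1⟩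
  · exact ⟨fun h => hAC h.2 h2, fun h => hAB h1 h.1, fun h => hAC h1 h.1⟩
  · exact ⟨fun h => hAB h.1 h1, fun h => hBC h.2 h2, fun h => hBC h1 h.1⟩

theorem cross' {V : Type*} {A B C : Finset V} (hAB : ∀ ⦃a : V⦄, a ∈ A → a ∉ B)
    (hAC : ∀ ⦃a : V⦄, a ∈ A → a ∉ C) (hBC : ∀ ⦃a : V⦄, a ∈ B → a ∉ C) {u v : V}
    (h : (u ∈ A ∧ v ∈ B) ∨ (u ∈ A ∧ v ∈ C) ∨ (u ∈ B ∧ v ∈ C)) :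
    ¬ (v ∈ A ∧ u ∈ A) ∧ ¬ (v ∈ B ∧ u ∈ B) ∧ ¬ (v ∈ C ∧ u ∈ C) := by
  obtain ⟨h1, h2, h3⟩ := cross hAB hAC hBC h
  exact ⟨fun h => h1 h.symm, fun h => h2 h.symm, fun h => h3 h.symm⟩

theorem rng_disj {n m : ℕ} (g : Fin n → ℕ × ℕ) (g' : Fin m → ℕ × ℕ) (h : ∀ i j, g i ≠ g' j) :
    ∀ x ∈ Set.range g, x ∉ Set.range g' := by
  rintro _ ⟨i, rfl⟩ ⟨j, hj⟩
  exact h i j hj.symm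

theorem rng_not {n : ℕ} (g : Fin n → ℕ × ℕ) (S : Set (ℕ × ℕ)) (h : ∀ i, g i ∉ S) :
    ∀ x ∈ Set.range g, x ∉ S := by
  rintro _ ⟨i, rfl⟩
  exact h i

theorem upbig {V : Type*} [Fintype V] [DecidableEq V] (G : SimpleGraph V) {A B C : Finset V}
    (H : TriPart G A B C) (hA : 4 ≤ A.card) (hB : 6 ≤ B.card) (h1 : A.card ≤ B.card)
    (h2 : B.card ≤ C.card) : Up G := by
  obtain ⟨hU, hAB, hAC, hBC, cA, cB, cC⟩ := H
  set wX : Sym2 V → ℕ := fun _ => 1 with hwX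
  have hone : ∀ v, PP wX v = 1 := fun v => by simp [wX, PP]
  obtain ⟨a, ha⟩ := Nat.exists_eq_add_of_le hA
  obtain ⟨b, hb⟩ := Nat.exists_eq_add_of_le hB
  obtain ⟨c, hc⟩ := Nat.exists_eq_add_of_le (le_trans hB h2)
  have RB := (rz_red (p := 3) (q := 2) (by decide) (by decide) (PP wX) (b + 2) B (by omega)
    (fun v _ => hone v)).swap
  have RC := rz_dia (PP wX) (c + 3) 2 3 (by decide) (by decide) C (by omega) (fun v _ => hone v)
  by_cases h4 : a = 0
  · have RA := rz_red (p := 2) (q := 3) (by decide) (by decide) (PP wX) a A (by omega)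
      (fun v _ => hone v)
    refine union_up G hU hAB hAC hBC cA cB cC wX (by simp [wX]) (by simp [wX]) RA RB RC ?_ ?_ ?_ <;>
    · rintro ⟨x, y⟩ hx hy
      simp only [mem_swap, mem_Sred, mem_Sdia] at hx hy
      omega
  · have RA := rz_iso (p := 2) (q := 3) (by decide) (by decide) (PP wX) (a + 1) A (by omega)
      (fun v _ => hone v)
    refine union_up G hU hAB hAC hBC cA cB cC wX (by simp [wX]) (by simp [wX]) RA RB RC ?_ ?_ ?_ <;>
    · rintro ⟨x, y⟩ hx hy
      simp only [mem_swap, mem_Sred, mem_Siso, mem_Sdia] at hx hy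
      omega

theorem up455 {V : Type*} [Fintype V] [DecidableEq V] (G : SimpleGraph V) {A B C : Finset V}
    (H : TriPart G A B C) (hA : A.card = 4) (hB : B.card = 5) (hC : C.card = 5) : Up G := by
  obtain ⟨hU, hAB, hAC, hBC, cA, cB, cC⟩ := H
  set wX : Sym2 V → ℕ := fun _ => 1 with hwX
  obtain ⟨eA, eA1, eA2⟩ := enum0 (n := 2) A hA
  have RA := Rz.table (p := 2) (q := 3) (h := PP wX) eA eA1 eA2
    ![![1, 1, 1, 1], ![1, 1, 1, 2], ![1, 1, 1, 3], ![1, 2, 3, 1]]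
    ![1, 1, 1, 1]
    ![(0, 0), (1, 0), (0, 1), (1, 1)]
    (fun i => by fin_cases i <;> simp [wX, PP]) (by decide) (by decide) (by decide)
  obtain ⟨eB, eB1, eB2⟩ := enum0 (n := 3) B hB
  have RB := Rz.table (p := 2) (q := 3) (h := PP wX) eB eB1 eB2
    ![![1, 1, 1, 3, 3], ![1, 1, 3, 2, 3], ![1, 3, 1, 3, 3], ![3, 2, 3, 1, 2], ![3, 3, 3, 2, 1]]
    ![1, 1, 1, 1, 1]
    ![(0, 2), (1, 2), (0, 3), (2, 2), (1, 3)]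
    (fun i => by fin_cases i <;> simp [wX, PP]) (by decide) (by decide) (by decide)
  obtain ⟨eC, eC1, eC2⟩ := enum0 (n := 3) C hC
  have RC := Rz.table (p := 2) (q := 3) (h := PP wX) eC eC1 eC2
    ![![1, 1, 1, 2, 2], ![1, 1, 2, 2, 2], ![1, 2, 1, 2, 3], ![2, 2, 2, 1, 2], ![2, 2, 3, 2, 1]]
    ![1, 1, 1, 1, 1]
    ![(2, 0), (3, 0), (2, 1), (4, 0), (3, 1)]
    (fun i => by fin_cases i <;> simp [wX, PP]) (by decide) (by decide) (by decide)
  exact union_up G hU hAB hAC hBC cA cB cC wX (by simp [wX]) (by simp [wX]) RA RB RC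
    (rng_disj _ _ (by decide)) (rng_disj _ _ (by decide)) (rng_disj _ _ (by decide))

theorem up555 {V : Type*} [Fintype V] [DecidableEq V] (G : SimpleGraph V) {A B C : Finset V}
    (H : TriPart G A B C) (hA : A.card = 5) (hB : B.card = 5) (hC : C.card = 5) : Up G := by
  obtain ⟨hU, hAB, hAC, hBC, cA, cB, cC⟩ := H
  set wX : Sym2 V → ℕ := fun _ => 1 with hwX
  obtain ⟨eA, eA1, eA2⟩ := enum0 (n := 3) A hA
  have RA := Rz.table (p := 2) (q := 3) (h := PP wX) eA eA1 eA2
    ![![1, 1, 1, 3, 3], ![1, 1, 3, 2, 3], ![1, 3, 1, 3, 3], ![3, 2, 3, 1, 3], ![3, 3, 3, 3, 1]]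
    ![1, 1, 1, 1, 1]
    ![(0, 2), (1, 2), (0, 3), (1, 3), (0, 4)]
    (fun i => by fin_cases i <;> simp [wX, PP]) (by decide) (by decide) (by decide)
  obtain ⟨eB, eB1, eB2⟩ := enum0 (n := 3) B hB
  have RB := Rz.table (p := 2) (q := 3) (h := PP wX) eB eB1 eB2
    ![![1, 1, 2, 2, 2], ![1, 1, 2, 2, 3], ![2, 2, 1, 2, 2], ![2, 2, 2, 1, 3], ![2, 3, 2, 3, 1]]
    ![1, 1, 1, 1, 1]
    ![(3, 0), (2, 1), (4, 0), (3, 1), (2, 2)]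
    (fun i => by fin_cases i <;> simp [wX, PP]) (by decide) (by decide) (by decide)
  obtain ⟨eC, eC1, eC2⟩ := enum0 (n := 3) C hC
  have RC := Rz.table (p := 2) (q := 3) (h := PP wX) eC eC1 eC2
    ![![1, 1, 1, 1, 1], ![1, 1, 1, 1, 2], ![1, 1, 1, 3, 1], ![1, 1, 3, 1, 2], ![1, 2, 1, 2, 1]]
    ![1, 1, 1, 1, 1]
    ![(0, 0), (1, 0), (0, 1), (1, 1), (2, 0)]
    (fun i => by fin_cases i <;> simp [wX, PP]) (by decide) (by decide) (by decide)
  exact union_up G hU hAB hAC hBC cA cB cC wX (by simp [wX]) (by simp [wX]) RA RB RC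
    (rng_disj _ _ (by decide)) (rng_disj _ _ (by decide)) (rng_disj _ _ (by decide))

theorem up45l {V : Type*} [Fintype V] [DecidableEq V] (G : SimpleGraph V) {A B C : Finset V}
    (H : TriPart G A B C) (hA : A.card = 4) (hB : B.card = 5) (hC : 6 ≤ C.card) : Up G := by
  obtain ⟨hU, hAB, hAC, hBC, cA, cB, cC⟩ := H
  set wX : Sym2 V → ℕ := fun _ => 1 with hwX
  obtain ⟨eA, eA1, eA2⟩ := enum0 (n := 2) A hA
  have RA := Rz.table (p := 2) (q := 3) (h := PP wX) eA eA1 eA2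
    ![![1, 1, 1, 1], ![1, 1, 1, 2], ![1, 1, 1, 3], ![1, 2, 3, 1]]
    ![1, 1, 1, 1]
    ![(0, 0), (1, 0), (0, 1), (1, 1)]
    (fun i => by fin_cases i <;> simp [wX, PP]) (by decide) (by decide) (by decide)
  obtain ⟨eB, eB1, eB2⟩ := enum0 (n := 3) B hB
  have RB := Rz.table (p := 2) (q := 3) (h := PP wX) eB eB1 eB2
    ![![1, 1, 1, 2, 2], ![1, 1, 3, 1, 3], ![1, 3, 1, 2, 3], ![2, 1, 2, 1, 3], ![2, 3, 3, 3, 1]]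
    ![1, 1, 1, 1, 1]
    ![(2, 0), (0, 2), (1, 2), (2, 1), (1, 3)]
    (fun i => by fin_cases i <;> simp [wX, PP]) (by decide) (by decide) (by decide)
  obtain ⟨k, hk⟩ := Nat.exists_eq_add_of_le hC
  have RC := rz_dia (PP wX) (k + 3) 2 3 (by decide) (by decide) C (by omega)
    (fun v _ => by simp [wX, PP])
  exact union_up G hU hAB hAC hBC cA cB cC wX (by simp [wX]) (by simp [wX]) RA RB RC
    (rng_disj _ _ (by decide)) 
    (rng_not _ _ (by intro i; fin_cases i <;> simp [mem_Sdia, mem_Sdia'] <;> omega))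
    (rng_not _ _ (by intro i; fin_cases i <;> simp [mem_Sdia, mem_Sdia'] <;> omega))

theorem up55l {V : Type*} [Fintype V] [DecidableEq V] (G : SimpleGraph V) {A B C : Finset V}
    (H : TriPart G A B C) (hA : A.card = 5) (hB : B.card = 5) (hC : 6 ≤ C.card) : Up G := by
  obtain ⟨hU, hAB, hAC, hBC, cA, cB, cC⟩ := H
  set wX : Sym2 V → ℕ := fun _ => 1 with hwX
  obtain ⟨eA, eA1, eA2⟩ := enum0 (n := 3) A hA
  have RA := Rz.table (p := 2) (q := 3) (h := PP wX) eA eA1 eA2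
    ![![1, 1, 1, 1, 1], ![1, 1, 1, 1, 2], ![1, 1, 1, 2, 2], ![1, 1, 2, 1, 3], ![1, 2, 2, 3, 1]]
    ![1, 1, 1, 1, 1]
    ![(0, 0), (1, 0), (2, 0), (1, 1), (2, 1)]
    (fun i => by fin_cases i <;> simp [wX, PP]) (by decide) (by decide) (by decide)
  obtain ⟨eB, eB1, eB2⟩ := enum0 (n := 3) B hB
  have RB := Rz.table (p := 2) (q := 3) (h := PP wX) eB eB1 eB2
    ![![1, 1, 1, 3, 3], ![1, 1, 3, 2, 3], ![1, 3, 1, 3, 3], ![3, 2, 3, 1, 3], ![3, 3, 3, 3, 1]]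
    ![1, 1, 1, 1, 1]
    ![(0, 2), (1, 2), (0, 3), (1, 3), (0, 4)]
    (fun i => by fin_cases i <;> simp [wX, PP]) (by decide) (by decide) (by decide)
  obtain ⟨k, hk⟩ := Nat.exists_eq_add_of_le hC
  have RC := rz_dia (PP wX) (k + 3) 2 3 (by decide) (by decide) C (by omega)
    (fun v _ => by simp [wX, PP])
  exact union_up G hU hAB hAC hBC cA cB cC wX (by simp [wX]) (by simp [wX]) RA RB RC
    (rng_disj _ _ (by decide)) 
    (rng_not _ _ (by intro i; fin_cases i <;> simp [mem_Sdia, mem_Sdia'] <;> omega))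
    (rng_not _ _ (by intro i; fin_cases i <;> simp [mem_Sdia, mem_Sdia'] <;> omega))

theorem up445i {V : Type*} [Fintype V] [DecidableEq V] (G : SimpleGraph V) {A B C : Finset V}
    (H : TriPart G A B C) (hA : A.card = 4) (hB : B.card = 4) (hC : C.card = 5)
    {a d : V} (ha : a ∈ A) (hd : d ∈ B) (hadj : G.Adj a d) : Up G := by
  obtain ⟨hU, hAB, hAC, hBC, cA, cB, cC⟩ := H
  rw [Finset.disjoint_left] at hAB hAC hBC
  set wX : Sym2 V → ℕ := wE a d with hwX
  have hP : ∀ v, PP wX v = if v = a ∨ v = d then 2 else 1 := PP_wE hadj.ne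
  obtain ⟨eA, eA1, eA2, eA0⟩ := enum1 (n := 2) A hA ha
  have mA : ∀ i, eA i ∈ A := fun i => by rw [← eA2]; simp
  have rA : ∀ i, PP wX (eA i) = if i = 0 then 2 else 1 := by
    intro i
    have q : eA i = a ↔ i = 0 := by rw [← eA0, eA1.eq_iff]
    rw [hP]
    have : eA i ≠ d := fun h => hAB (h ▸ mA i) hd
    simp [this, q]
  have RA := Rz.table (p := 2) (q := 3) (h := PP wX) eA eA1 eA2
    ![![1, 1, 2, 2], ![1, 1, 1, 3], ![2, 1, 1, 1], ![2, 3, 1, 1]]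
    ![2, 1, 1, 1]
    ![(3, 0), (0, 1), (1, 0), (1, 1)]
    (fun i => by rw [rA]; fin_cases i <;> simp) (by decide) (by decide) (by decide)
  obtain ⟨eB, eB1, eB2, eB0⟩ := enum1 (n := 2) B hB hd
  have mB : ∀ i, eB i ∈ B := fun i => by rw [← eB2]; simp
  have rB : ∀ i, PP wX (eB i) = if i = 0 then 2 else 1 := by
    intro i
    have q : eB i = d ↔ i = 0 := by rw [← eB0, eB1.eq_iff]
    rw [hP]
    have : eB i ≠ a := fun h => hAB ha (h ▸ mB i)
    simp [this, q]
  have RB := Rz.table (p := 2) (q := 3) (h := PP wX) eB eB1 eB2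
    ![![1, 2, 2, 3], ![2, 1, 2, 1], ![2, 2, 1, 3], ![3, 1, 3, 1]]
    ![2, 1, 1, 1]
    ![(3, 1), (2, 0), (2, 1), (0, 2)]
    (fun i => by rw [rB]; fin_cases i <;> simp) (by decide) (by decide) (by decide)
  obtain ⟨eC, eC1, eC2⟩ := enum0 (n := 3) C hC
  have mC : ∀ i, eC i ∈ C := fun i => by rw [← eC2]; simp
  have rC : ∀ i, PP wX (eC i) = 1 := by
    intro i
    rw [hP]
    have h1 : eC i ≠ a := fun h => hAC ha (h ▸ mC i)
    have h2 : eC i ≠ d := (fun h => hBC hd (h ▸ mC i))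
    simp [h1, h2]
  have RC := Rz.table (p := 2) (q := 3) (h := PP wX) eC eC1 eC2
    ![![1, 1, 2, 3, 3], ![1, 1, 3, 3, 3], ![2, 3, 1, 2, 3], ![3, 3, 2, 1, 3], ![3, 3, 3, 3, 1]]
    ![1, 1, 1, 1, 1]
    ![(1, 2), (0, 3), (2, 2), (1, 3), (0, 4)]
    (fun i => by rw [rC]; fin_cases i <;> simp) (by decide) (by decide) (by decide)
  refine union_up G hU (Finset.disjoint_left.2 hAB) (Finset.disjoint_left.2 hAC)
    (Finset.disjoint_left.2 hBC) cA cB cC wX (wE_mem a d) ?_ RA RB RC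
    (rng_disj _ _ (by decide)) (rng_disj _ _ (by decide)) (rng_disj _ _ (by decide))
  intro u v huv
  obtain (⟨rfl, rfl⟩ | ⟨rfl, rfl⟩) := wE_ne huv
  · refine ⟨hadj, ?_⟩
    exact cross hAB hAC hBC (by simp [ha, hd])
  · refine ⟨hadj.symm, ?_⟩
    exact cross' hAB hAC hBC (by simp [ha, hd])

theorem up445ii {V : Type*} [Fintype V] [DecidableEq V] (G : SimpleGraph V) {A B C : Finset V}
    (H : TriPart G A B C) (hA : A.card = 4) (hB : B.card = 4) (hC : C.card = 5)
    {a d : V} (ha : a ∈ A) (hd : d ∈ C) (hadj : G.Adj a d) : Up G := by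
  obtain ⟨hU, hAB, hAC, hBC, cA, cB, cC⟩ := H
  rw [Finset.disjoint_left] at hAB hAC hBC
  set wX : Sym2 V → ℕ := wE a d with hwX
  have hP : ∀ v, PP wX v = if v = a ∨ v = d then 2 else 1 := PP_wE hadj.ne
  obtain ⟨eA, eA1, eA2, eA0⟩ := enum1 (n := 2) A hA ha
  have mA : ∀ i, eA i ∈ A := fun i => by rw [← eA2]; simp
  have rA : ∀ i, PP wX (eA i) = if i = 0 then 2 else 1 := by
    intro i
    have q : eA i = a ↔ i = 0 := by rw [← eA0, eA1.eq_iff]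
    rw [hP]
    have : eA i ≠ d := fun h => hAC (h ▸ mA i) hd
    simp [this, q]
  have RA := Rz.table (p := 2) (q := 3) (h := PP wX) eA eA1 eA2
    ![![1, 1, 1, 2], ![1, 1, 1, 2], ![1, 1, 1, 3], ![2, 2, 3, 1]]
    ![2, 1, 1, 1]
    ![(2, 0), (1, 0), (0, 1), (2, 1)]
    (fun i => by rw [rA]; fin_cases i <;> simp) (by decide) (by decide) (by decide)
  obtain ⟨eB, eB1, eB2⟩ := enum0 (n := 2) B hB
  have mB : ∀ i, eB i ∈ B := fun i => by rw [← eB2]; simp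
  have rB : ∀ i, PP wX (eB i) = 1 := by
    intro i
    rw [hP]
    have h1 : eB i ≠ a := fun h => hAB ha (h ▸ mB i)
    have h2 : eB i ≠ d := (fun h => hBC (h ▸ mB i) hd)
    simp [h1, h2]
  have RB := Rz.table (p := 2) (q := 3) (h := PP wX) eB eB1 eB2
    ![![1, 1, 2, 3], ![1, 1, 3, 3], ![2, 3, 1, 3], ![3, 3, 3, 1]]
    ![1, 1, 1, 1]
    ![(1, 1), (0, 2), (1, 2), (0, 3)]
    (fun i => by rw [rB]; fin_cases i <;> simp) (by decide) (by decide) (by decide)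
  obtain ⟨eC, eC1, eC2, eC0⟩ := enum1 (n := 3) C hC hd
  have mC : ∀ i, eC i ∈ C := fun i => by rw [← eC2]; simp
  have rC : ∀ i, PP wX (eC i) = if i = 0 then 2 else 1 := by
    intro i
    have q : eC i = d ↔ i = 0 := by rw [← eC0, eC1.eq_iff]
    rw [hP]
    have : eC i ≠ a := fun h => hAC ha (h ▸ mC i)
    simp [this, q]
  have RC := Rz.table (p := 2) (q := 3) (h := PP wX) eC eC1 eC2
    ![![1, 2, 2, 3, 3], ![2, 1, 2, 2, 2], ![2, 2, 1, 2, 3], ![3, 2, 2, 1, 3], ![3, 2, 3, 3, 1]]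
    ![2, 1, 1, 1, 1]
    ![(3, 2), (4, 0), (3, 1), (2, 2), (1, 3)]
    (fun i => by rw [rC]; fin_cases i <;> simp) (by decide) (by decide) (by decide)
  refine union_up G hU (Finset.disjoint_left.2 hAB) (Finset.disjoint_left.2 hAC)
    (Finset.disjoint_left.2 hBC) cA cB cC wX (wE_mem a d) ?_ RA RB RC
    (rng_disj _ _ (by decide)) (rng_disj _ _ (by decide)) (rng_disj _ _ (by decide))
  intro u v huv
  obtain (⟨rfl, rfl⟩ | ⟨rfl, rfl⟩) := wE_ne huv
  · refine ⟨hadj, ?_⟩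
    exact cross hAB hAC hBC (by simp [ha, hd])
  · refine ⟨hadj.symm, ?_⟩
    exact cross' hAB hAC hBC (by simp [ha, hd])

theorem up44li {V : Type*} [Fintype V] [DecidableEq V] (G : SimpleGraph V) {A B C : Finset V}
    (H : TriPart G A B C) (hA : A.card = 4) (hB : B.card = 4) (hC : 6 ≤ C.card)
    {a d : V} (ha : a ∈ A) (hd : d ∈ B) (hadj : G.Adj a d) : Up G := by
  obtain ⟨hU, hAB, hAC, hBC, cA, cB, cC⟩ := H
  rw [Finset.disjoint_left] at hAB hAC hBC
  set wX : Sym2 V → ℕ := wE a d with hwX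
  have hP : ∀ v, PP wX v = if v = a ∨ v = d then 2 else 1 := PP_wE hadj.ne
  obtain ⟨eA, eA1, eA2, eA0⟩ := enum1 (n := 2) A hA ha
  have mA : ∀ i, eA i ∈ A := fun i => by rw [← eA2]; simp
  have rA : ∀ i, PP wX (eA i) = if i = 0 then 2 else 1 := by
    intro i
    have q : eA i = a ↔ i = 0 := by rw [← eA0, eA1.eq_iff]
    rw [hP]
    have : eA i ≠ d := fun h => hAB (h ▸ mA i) hd
    simp [this, q]
  have RA := Rz.table (p := 2) (q := 3) (h := PP wX) eA eA1 eA2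
    ![![1, 1, 1, 2], ![1, 1, 1, 1], ![1, 1, 1, 3], ![2, 1, 3, 1]]
    ![2, 1, 1, 1]
    ![(2, 0), (0, 0), (0, 1), (1, 1)]
    (fun i => by rw [rA]; fin_cases i <;> simp) (by decide) (by decide) (by decide)
  obtain ⟨eB, eB1, eB2, eB0⟩ := enum1 (n := 2) B hB hd
  have mB : ∀ i, eB i ∈ B := fun i => by rw [← eB2]; simp
  have rB : ∀ i, PP wX (eB i) = if i = 0 then 2 else 1 := by
    intro i
    have q : eB i = d ↔ i = 0 := by rw [← eB0, eB1.eq_iff]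
    rw [hP]
    have : eB i ≠ a := fun h => hAB ha (h ▸ mB i)
    simp [this, q]
  have RB := Rz.table (p := 2) (q := 3) (h := PP wX) eB eB1 eB2
    ![![1, 1, 2, 3], ![1, 1, 3, 3], ![2, 3, 1, 3], ![3, 3, 3, 1]]
    ![2, 1, 1, 1]
    ![(2, 1), (0, 2), (1, 2), (0, 3)]
    (fun i => by rw [rB]; fin_cases i <;> simp) (by decide) (by decide) (by decide)
  obtain ⟨k, hk⟩ := Nat.exists_eq_add_of_le hC
  have RC := rz_dia (PP wX) (k + 3) 2 3 (by decide) (by decide) C (by omega) (by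
    intro v hv
    rw [hP]
    have h1 : v ≠ a := fun h => hAC ha (h ▸ hv)
    have h2 : v ≠ d := fun h => hBC hd (h ▸ hv)
    simp [h1, h2])
  refine union_up G hU (Finset.disjoint_left.2 hAB) (Finset.disjoint_left.2 hAC)
    (Finset.disjoint_left.2 hBC) cA cB cC wX (wE_mem a d) ?_ RA RB RC
    (rng_disj _ _ (by decide)) 
    (rng_not _ _ (by intro i; fin_cases i <;> simp [mem_Sdia, mem_Sdia'] <;> omega))
    (rng_not _ _ (by intro i; fin_cases i <;> simp [mem_Sdia, mem_Sdia'] <;> omega))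
  intro u v huv
  obtain (⟨rfl, rfl⟩ | ⟨rfl, rfl⟩) := wE_ne huv
  · refine ⟨hadj, ?_⟩
    exact cross hAB hAC hBC (by simp [ha, hd])
  · refine ⟨hadj.symm, ?_⟩
    exact cross' hAB hAC hBC (by simp [ha, hd])

theorem up44lii {V : Type*} [Fintype V] [DecidableEq V] (G : SimpleGraph V) {A B C : Finset V}
    (H : TriPart G A B C) (hA : A.card = 4) (hB : B.card = 4) (hC : 6 ≤ C.card)
    {a d : V} (ha : a ∈ A) (hd : d ∈ C) (hadj : G.Adj a d) : Up G := by
  obtain ⟨hU, hAB, hAC, hBC, cA, cB, cC⟩ := H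
  rw [Finset.disjoint_left] at hAB hAC hBC
  set wX : Sym2 V → ℕ := wE a d with hwX
  have hP : ∀ v, PP wX v = if v = a ∨ v = d then 2 else 1 := PP_wE hadj.ne
  obtain ⟨eA, eA1, eA2, eA0⟩ := enum1 (n := 2) A hA ha
  have mA : ∀ i, eA i ∈ A := fun i => by rw [← eA2]; simp
  have rA : ∀ i, PP wX (eA i) = if i = 0 then 2 else 1 := by
    intro i
    have q : eA i = a ↔ i = 0 := by rw [← eA0, eA1.eq_iff]
    rw [hP]
    have : eA i ≠ d := fun h => hAC (h ▸ mA i) hd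
    simp [this, q]
  have RA := Rz.table (p := 2) (q := 3) (h := PP wX) eA eA1 eA2
    ![![1, 1, 1, 2], ![1, 1, 1, 2], ![1, 1, 1, 3], ![2, 2, 3, 1]]
    ![2, 1, 1, 1]
    ![(2, 0), (1, 0), (0, 1), (2, 1)]
    (fun i => by rw [rA]; fin_cases i <;> simp) (by decide) (by decide) (by decide)
  obtain ⟨eB, eB1, eB2⟩ := enum0 (n := 2) B hB
  have mB : ∀ i, eB i ∈ B := fun i => by rw [← eB2]; simp
  have rB : ∀ i, PP wX (eB i) = 1 := by
    intro i
    rw [hP]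
    have h1 : eB i ≠ a := fun h => hAB ha (h ▸ mB i)
    have h2 : eB i ≠ d := (fun h => hBC (h ▸ mB i) hd)
    simp [h1, h2]
  have RB := Rz.table (p := 2) (q := 3) (h := PP wX) eB eB1 eB2
    ![![1, 1, 2, 3], ![1, 1, 3, 3], ![2, 3, 1, 3], ![3, 3, 3, 1]]
    ![1, 1, 1, 1]
    ![(1, 1), (0, 2), (1, 2), (0, 3)]
    (fun i => by rw [rB]; fin_cases i <;> simp) (by decide) (by decide) (by decide)
  obtain ⟨k, hk⟩ := Nat.exists_eq_add_of_le hC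
  have RC := rz_dia' (PP wX) (k + 2) 2 3 (by decide) (by decide) C (by omega) d hd
    (by rw [hP]; simp) (by
    intro v hv hvd
    rw [hP]
    have h1 : v ≠ a := fun h => hAC ha (h ▸ hv)
    simp [h1, hvd])
  refine union_up G hU (Finset.disjoint_left.2 hAB) (Finset.disjoint_left.2 hAC)
    (Finset.disjoint_left.2 hBC) cA cB cC wX (wE_mem a d) ?_ RA RB RC
    (rng_disj _ _ (by decide)) 
    (rng_not _ _ (by intro i; fin_cases i <;> simp [mem_Sdia, mem_Sdia'] <;> omega))
    (rng_not _ _ (by intro i; fin_cases i <;> simp [mem_Sdia, mem_Sdia'] <;> omega))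
  intro u v huv
  obtain (⟨rfl, rfl⟩ | ⟨rfl, rfl⟩) := wE_ne huv
  · refine ⟨hadj, ?_⟩
    exact cross hAB hAC hBC (by simp [ha, hd])
  · refine ⟨hadj.symm, ?_⟩
    exact cross' hAB hAC hBC (by simp [ha, hd])

theorem up444s {V : Type*} [Fintype V] [DecidableEq V] (G : SimpleGraph V) {A B C : Finset V}
    (H : TriPart G A B C) (hA : A.card = 4) (hB : B.card = 4) (hC : C.card = 4)
    {a b c : V} (ha : a ∈ A) (hb : b ∈ B) (hc : c ∈ C)
    (h1 : G.Adj a b) (h2 : G.Adj b c) : Up G := by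
  obtain ⟨hU, hAB, hAC, hBC, cA, cB, cC⟩ := H
  rw [Finset.disjoint_left] at hAB hAC hBC
  set wX : Sym2 V → ℕ := fun e => wE a b e * wE b c e with hwX
  have hP : ∀ v, PP wX v = (if v = a ∨ v = b then 2 else 1) * (if v = b ∨ v = c then 2 else 1) := by
    intro v
    rw [hwX, PP_mul, PP_wE h1.ne, PP_wE h2.ne]
  obtain ⟨eA, eA1, eA2, eA0⟩ := enum1 (n := 2) A hA ha
  obtain ⟨eB, eB1, eB2, eB0⟩ := enum1 (n := 2) B hB hb
  obtain ⟨eC, eC1, eC2, eC0⟩ := enum1 (n := 2) C hC hc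
  have mA : ∀ i, eA i ∈ A := fun i => by rw [← eA2]; simp
  have mB : ∀ i, eB i ∈ B := fun i => by rw [← eB2]; simp
  have mC : ∀ i, eC i ∈ C := fun i => by rw [← eC2]; simp
  have rA : ∀ i, PP wX (eA i) = if i = 0 then 2 else 1 := by
    intro i
    have q : eA i = a ↔ i = 0 := by rw [← eA0, eA1.eq_iff]
    rw [hP]
    have k1 : eA i ≠ b := fun h => hAB (h ▸ mA i) hb
    have k2 : eA i ≠ b := fun h => hAB (h ▸ mA i) hb
    have k3 : eA i ≠ c := fun h => hAC (h ▸ mA i) hc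
    simp [k1, k2, k3, q]
  have rC : ∀ i, PP wX (eC i) = if i = 0 then 2 else 1 := by
    intro i
    have q : eC i = c ↔ i = 0 := by rw [← eC0, eC1.eq_iff]
    rw [hP]
    have k1 : eC i ≠ b := fun h => hBC hb (h ▸ mC i)
    have k2 : eC i ≠ b := fun h => hBC hb (h ▸ mC i)
    have k3 : eC i ≠ a := fun h => hAC ha (h ▸ mC i)
    simp [k1, k2, k3, q]
  have rB : ∀ i, PP wX (eB i) = (if i = 0 then 2 else 1) * (if i = 0 then 2 else 1) := by
    intro i
    have k1 : eB i ≠ a := fun h => hAB ha (h ▸ mB i)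
    have k2 : eB i ≠ c := fun h => hBC (h ▸ mB i) hc
    rw [hP]
    have q : eB i = b ↔ i = 0 := by rw [← eB0, eB1.eq_iff]
    have q' : eB i = b ↔ i = 0 := by rw [← eB0, eB1.eq_iff]
    simp only [k1, k2, or_false, false_or, q, q']
  have RA := Rz.table (p := 2) (q := 3) (h := PP wX) eA eA1 eA2
    ![![1, 1, 1, 3], ![1, 1, 1, 1], ![1, 1, 1, 3], ![3, 1, 3, 1]]
    ![2, 1, 1, 1]
    ![(1, 1), (0, 0), (0, 1), (0, 2)]
    (fun i => by rw [rA]; fin_cases i <;> simp) (by decide) (by decide) (by decide)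
  have RB := Rz.table (p := 2) (q := 3) (h := PP wX) eB eB1 eB2
    ![![1, 1, 2, 2], ![1, 1, 1, 2], ![2, 1, 1, 2], ![2, 2, 2, 1]]
    ![4, 1, 1, 1]
    ![(4, 0), (1, 0), (2, 0), (3, 0)]
    (fun i => by rw [rB]; fin_cases i <;> simp) (by decide) (by decide) (by decide)
  have RC := Rz.table (p := 2) (q := 3) (h := PP wX) eC eC1 eC2
    ![![1, 2, 3, 3], ![2, 1, 2, 3], ![3, 2, 1, 3], ![3, 3, 3, 1]]
    ![2, 1, 1, 1]
    ![(2, 2), (2, 1), (1, 2), (0, 3)]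
    (fun i => by rw [rC]; fin_cases i <;> simp) (by decide) (by decide) (by decide)
  refine union_up G hU (Finset.disjoint_left.2 hAB) (Finset.disjoint_left.2 hAC)
    (Finset.disjoint_left.2 hBC) cA cB cC wX ?_ ?_ RA RB RC
    (rng_disj _ _ (by decide)) (rng_disj _ _ (by decide)) (rng_disj _ _ (by decide))
  · intro e
    have q1 := wE_mem a b e
    have q2 := wE_mem b c e
    simp only [hwX]
    by_cases w1 : wE a b e = 1
    · rw [w1, one_mul]; exact q2
    · by_cases w2 : wE b c e = 1
      · rw [w2, mul_one]; exact q1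
      · exfalso
        induction e using Sym2.ind with
        | _ u v =>
          have z := wE_ne w1
          have z' := wE_ne w2
          have i1 : a ≠ b := fun h => hAB ha (h ▸ hb)
          have i2 : a ≠ c := fun h => hAC ha (h ▸ hc)
          rcases z with ⟨rfl, rfl⟩ | ⟨rfl, rfl⟩ <;> rcases z' with ⟨z1, z2⟩ | ⟨z1, z2⟩
          · exact i1 z1
          · exact i2 z1
          · exact i2 z2
          · exact i1 z2
  · intro u v huv
    have : wE a b s(u, v) ≠ 1 ∨ wE b c s(u, v) ≠ 1 := by
      by_contra hcon
      push Not at hcon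
      apply huv
      simp only [hwX, hcon.1, hcon.2, mul_one]
    rcases this with h | h
    · obtain (⟨rfl, rfl⟩ | ⟨rfl, rfl⟩) := wE_ne h
      · exact ⟨h1, cross hAB hAC hBC (by simp [ha, hb])⟩
      · exact ⟨h1.symm, cross' hAB hAC hBC (by simp [ha, hb])⟩
    · obtain (⟨rfl, rfl⟩ | ⟨rfl, rfl⟩) := wE_ne h
      · exact ⟨h2, cross hAB hAC hBC (by simp [hb, hc])⟩
      · exact ⟨h2.symm, cross' hAB hAC hBC (by simp [hb, hc])⟩

theorem up444d {V : Type*} [Fintype V] [DecidableEq V] (G : SimpleGraph V) {A B C : Finset V}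
    (H : TriPart G A B C) (hA : A.card = 4) (hB : B.card = 4) (hC : C.card = 4)
    {a b b' c : V} (ha : a ∈ A) (hb : b ∈ B) (hb' : b' ∈ B) (hbb : b ≠ b') (hc : c ∈ C)
    (h1 : G.Adj a b) (h2 : G.Adj b' c) : Up G := by
  obtain ⟨hU, hAB, hAC, hBC, cA, cB, cC⟩ := H
  rw [Finset.disjoint_left] at hAB hAC hBC
  set wX : Sym2 V → ℕ := fun e => wE a b e * wE b' c e with hwX
  have hP : ∀ v, PP wX v = (if v = a ∨ v = b then 2 else 1) * (if v = b' ∨ v = c then 2 else 1) := by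
    intro v
    rw [hwX, PP_mul, PP_wE h1.ne, PP_wE h2.ne]
  obtain ⟨eA, eA1, eA2, eA0⟩ := enum1 (n := 2) A hA ha
  obtain ⟨eB, eB1, eB2, eB0, eB0'⟩ := enum2 (n := 2) B hB hb hb' hbb
  obtain ⟨eC, eC1, eC2, eC0⟩ := enum1 (n := 2) C hC hc
  have mA : ∀ i, eA i ∈ A := fun i => by rw [← eA2]; simp
  have mB : ∀ i, eB i ∈ B := fun i => by rw [← eB2]; simp
  have mC : ∀ i, eC i ∈ C := fun i => by rw [← eC2]; simp
  have rA : ∀ i, PP wX (eA i) = if i = 0 then 2 else 1 := by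
    intro i
    have q : eA i = a ↔ i = 0 := by rw [← eA0, eA1.eq_iff]
    rw [hP]
    have k1 : eA i ≠ b := fun h => hAB (h ▸ mA i) hb
    have k2 : eA i ≠ b' := fun h => hAB (h ▸ mA i) hb'
    have k3 : eA i ≠ c := fun h => hAC (h ▸ mA i) hc
    simp [k1, k2, k3, q]
  have rC : ∀ i, PP wX (eC i) = if i = 0 then 2 else 1 := by
    intro i
    have q : eC i = c ↔ i = 0 := by rw [← eC0, eC1.eq_iff]
    rw [hP]
    have k1 : eC i ≠ b := fun h => hBC hb (h ▸ mC i)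
    have k2 : eC i ≠ b' := fun h => hBC hb' (h ▸ mC i)
    have k3 : eC i ≠ a := fun h => hAC ha (h ▸ mC i)
    simp [k1, k2, k3, q]
  have rB : ∀ i, PP wX (eB i) = (if i = 0 then 2 else 1) * (if i = 1 then 2 else 1) := by
    intro i
    have k1 : eB i ≠ a := fun h => hAB ha (h ▸ mB i)
    have k2 : eB i ≠ c := fun h => hBC (h ▸ mB i) hc
    rw [hP]
    have q : eB i = b ↔ i = 0 := by rw [← eB0, eB1.eq_iff]
    have q' : eB i = b' ↔ i = 1 := by rw [← eB0', eB1.eq_iff]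
    simp only [k1, k2, or_false, false_or, q, q']
  have RA := Rz.table (p := 2) (q := 3) (h := PP wX) eA eA1 eA2
    ![![1, 1, 1, 3], ![1, 1, 1, 1], ![1, 1, 1, 3], ![3, 1, 3, 1]]
    ![2, 1, 1, 1]
    ![(1, 1), (0, 0), (0, 1), (0, 2)]
    (fun i => by rw [rA]; fin_cases i <;> simp) (by decide) (by decide) (by decide)
  have RB := Rz.table (p := 2) (q := 3) (h := PP wX) eB eB1 eB2
    ![![1, 2, 1, 2], ![2, 1, 2, 2], ![1, 2, 1, 1], ![2, 2, 1, 1]]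
    ![2, 2, 1, 1]
    ![(3, 0), (4, 0), (1, 0), (2, 0)]
    (fun i => by rw [rB]; fin_cases i <;> simp) (by decide) (by decide) (by decide)
  have RC := Rz.table (p := 2) (q := 3) (h := PP wX) eC eC1 eC2
    ![![1, 2, 3, 3], ![2, 1, 2, 3], ![3, 2, 1, 3], ![3, 3, 3, 1]]
    ![2, 1, 1, 1]
    ![(2, 2), (2, 1), (1, 2), (0, 3)]
    (fun i => by rw [rC]; fin_cases i <;> simp) (by decide) (by decide) (by decide)
  refine union_up G hU (Finset.disjoint_left.2 hAB) (Finset.disjoint_left.2 hAC)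
    (Finset.disjoint_left.2 hBC) cA cB cC wX ?_ ?_ RA RB RC
    (rng_disj _ _ (by decide)) (rng_disj _ _ (by decide)) (rng_disj _ _ (by decide))
  · intro e
    have q1 := wE_mem a b e
    have q2 := wE_mem b' c e
    simp only [hwX]
    by_cases w1 : wE a b e = 1
    · rw [w1, one_mul]; exact q2
    · by_cases w2 : wE b' c e = 1
      · rw [w2, mul_one]; exact q1
      · exfalso
        induction e using Sym2.ind with
        | _ u v =>
          have z := wE_ne w1
          have z' := wE_ne w2
          have i1 : a ≠ b' := fun h => hAB ha (h ▸ hb')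
          have i2 : a ≠ c := fun h => hAC ha (h ▸ hc)
          rcases z with ⟨rfl, rfl⟩ | ⟨rfl, rfl⟩ <;> rcases z' with ⟨z1, z2⟩ | ⟨z1, z2⟩
          · exact i1 z1
          · exact i2 z1
          · exact i2 z2
          · exact i1 z2
  · intro u v huv
    have : wE a b s(u, v) ≠ 1 ∨ wE b' c s(u, v) ≠ 1 := by
      by_contra hcon
      push Not at hcon
      apply huv
      simp only [hwX, hcon.1, hcon.2, mul_one]
    rcases this with h | h
    · obtain (⟨rfl, rfl⟩ | ⟨rfl, rfl⟩) := wE_ne h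
      · exact ⟨h1, cross hAB hAC hBC (by simp [ha, hb])⟩
      · exact ⟨h1.symm, cross' hAB hAC hBC (by simp [ha, hb])⟩
    · obtain (⟨rfl, rfl⟩ | ⟨rfl, rfl⟩) := wE_ne h
      · exact ⟨h2, cross hAB hAC hBC (by simp [hb', hc])⟩
      · exact ⟨h2.symm, cross' hAB hAC hBC (by simp [hb', hc])⟩

theorem TriPart.perm1 {V : Type*} [Fintype V] [DecidableEq V] {G : SimpleGraph V} {A B C : Finset V}
    (H : TriPart G A B C) : TriPart G B A C := by
  obtain ⟨hU, hAB, hAC, hBC, cA, cB, cC⟩ := H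
  exact ⟨by rw [Finset.union_comm B A]; exact hU, hAB.symm, hBC, hAC, cB, cA, cC⟩

theorem TriPart.perm2 {V : Type*} [Fintype V] [DecidableEq V] {G : SimpleGraph V} {A B C : Finset V}
    (H : TriPart G A B C) : TriPart G A C B := by
  obtain ⟨hU, hAB, hAC, hBC, cA, cB, cC⟩ := H
  exact ⟨by rw [Finset.union_assoc, Finset.union_comm C B, ← Finset.union_assoc]; exact hU,
    hAC, hAB, hBC.symm, cA, cC, cB⟩

theorem TriPart.out {V : Type*} [Fintype V] [DecidableEq V] {G : SimpleGraph V} {A B C : Finset V}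
    (H : TriPart G A B C) (hconn : G.Connected) (hA : 0 < A.card) (hB : 0 < B.card) :
    ∃ a ∈ A, ∃ d, (d ∈ B ∨ d ∈ C) ∧ G.Adj a d := by
  obtain ⟨hU, hAB, hAC, hBC, cA, cB, cC⟩ := H
  obtain ⟨a, ha⟩ := Finset.card_pos.1 hA
  obtain ⟨b, hb⟩ := Finset.card_pos.1 hB
  obtain ⟨u, hu, v, hv, huv⟩ := out_edge G hconn A ha (fun h => Finset.disjoint_left.1 hAB h hb)
  refine ⟨u, hu, v, ?_, huv⟩
  have : v ∈ A ∪ B ∪ C := by rw [hU]; simp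
  simp only [Finset.mem_union] at this
  tauto

theorem up444 {V : Type*} [Fintype V] [DecidableEq V] (G : SimpleGraph V) {A B C : Finset V}
    (H : TriPart G A B C) (hA : A.card = 4) (hB : B.card = 4) (hC : C.card = 4)
    {a b b' c : V} (ha : a ∈ A) (hb : b ∈ B) (hb' : b' ∈ B) (hc : c ∈ C)
    (h1 : G.Adj a b) (h2 : G.Adj b' c) : Up G := by
  by_cases hbb : b = b'
  · subst hbb
    exact up444s G H hA hB hC ha hb hc h1 h2
  · exact up444d G H hA hB hC ha hb hb' hbb hc h1 h2

theorem up444' {V : Type*} [Fintype V] [DecidableEq V] (G : SimpleGraph V) (hconn : G.Connected)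
    {A B C : Finset V}
    (H : TriPart G A B C) (hA : A.card = 4) (hB : B.card = 4) (hC : C.card = 4)
    {a b : V} (ha : a ∈ A) (hb : b ∈ B) (h1 : G.Adj a b) : Up G := by
  obtain ⟨c, hc, d, hd, hcd⟩ := H.perm2.perm1.out hconn (by omega) (by omega)
  rcases hd with hd | hd
  · exact up444 G H.perm1 hB hA hC hb ha hd hc h1.symm hcd.symm
  · exact up444 G H hA hB hC ha hb hd hc h1 hcd.symm

theorem up_sorted {V : Type*} [Fintype V] [DecidableEq V] (G : SimpleGraph V)
    (hconn : G.Connected) {A B C : Finset V} (H : TriPart G A B C) (hA : 4 ≤ A.card)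
    (h1 : A.card ≤ B.card) (h2 : B.card ≤ C.card) : Up G := by
  by_cases hB : 6 ≤ B.card
  · exact upbig G H hA hB h1 h2
  by_cases hB5 : B.card = 5
  · by_cases hC : 6 ≤ C.card
    · by_cases hA4 : A.card = 4
      · exact up45l G H hA4 hB5 hC
      · exact up55l G H (by omega) hB5 hC
    · by_cases hA4 : A.card = 4
      · exact up455 G H hA4 hB5 (by omega)
      · exact up555 G H (by omega) hB5 (by omega)
  have hB4 : B.card = 4 := by omega
  have hA4 : A.card = 4 := by omega
  obtain ⟨a, ha, d, hd, had⟩ := H.out hconn (by omega) (by omega)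
  by_cases hC : 6 ≤ C.card
  · rcases hd with hd | hd
    · exact up44li G H hA4 hB4 hC ha hd had
    · exact up44lii G H hA4 hB4 hC ha hd had
  by_cases hC5 : C.card = 5
  · rcases hd with hd | hd
    · exact up445i G H hA4 hB4 hC5 ha hd had
    · exact up445ii G H hA4 hB4 hC5 ha hd had
  have hC4 : C.card = 4 := by omega
  rcases hd with hd | hd
  · exact up444' G hconn H hA4 hB4 hC4 ha hd had
  · exact up444' G hconn H.perm2 hA4 hC4 hB4 ha hd had

theorem up_all {V : Type*} [Fintype V] [DecidableEq V] (G : SimpleGraph V)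
    (hconn : G.Connected) {A B C : Finset V} (H : TriPart G A B C) (hA : 4 ≤ A.card)
    (hB : 4 ≤ B.card) (hC : 4 ≤ C.card) : Up G := by
  rcases le_total A.card B.card with h1 | h1 <;> rcases le_total B.card C.card with h2 | h2 <;>
    rcases le_total A.card C.card with h3 | h3
  · exact up_sorted G hconn H hA h1 h2
  · exact up_sorted G hconn H hA h1 h2
  · exact up_sorted G hconn H.perm2 hA h3 h2
  · exact up_sorted G hconn H.perm2.perm1 hC h3 h1
  · exact up_sorted G hconn H.perm1 hB h1 h3
  · exact up_sorted G hconn H.perm1.perm2 hB h2 h3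
  · exact up_sorted G hconn H.perm2.perm1.perm2 hC h2 h1
  · exact up_sorted G hconn H.perm2.perm1.perm2 hC h2 h1

/-- Every connected graph whose vertex set can be partitioned into three cliques, each of
size at least `4`, has product irregularity strength `3`. -/
theorem stmt_18 {V : Type*} [Fintype V] [DecidableEq V] (G : SimpleGraph V)
    (hconn : G.Connected)
    (hcover : ∃ A B C : Finset V,
      A ∪ B ∪ C = Finset.univ ∧
      Disjoint A B ∧ Disjoint A C ∧ Disjoint B C ∧
      G.IsClique (A : Set V) ∧ G.IsClique (B : Set V) ∧ G.IsClique (C : Set V) ∧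
      4 ≤ A.card ∧ 4 ≤ B.card ∧ 4 ≤ C.card) :
    ps G = 3 := by
  obtain ⟨A, B, C, hU, hAB, hAC, hBC, cA, cB, cC, hA, hB, hC⟩ := hcover
  have hup : Up G := up_all G hconn ⟨hU, hAB, hAC, hBC, cA, cB, cC⟩ hA hB hC
  have hV : 2 ≤ Fintype.card V := le_trans (by omega) (Finset.card_le_univ A)
  apply le_antisymm
  · exact Nat.sInf_le hup
  · obtain ⟨w, hw, hi⟩ := Nat.sInf_mem (s := {s : ℕ | ∃ w : Sym2 V → ℕ,
      (∀ u v : V, G.Adj u v → w s(u, v) ∈ Finset.Icc 1 s) ∧ ProductIrregular G w}) ⟨3, hup⟩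
    exact lower G hV _ w hw hi
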